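/- arXiv:2106.07129 — 7 statements merged into one kernel-verified Lean document; each statement's English description precedes it below -/
import Mathlib

section
/- Let λ_1, …, λ_n be pairwise distinct real numbers. Let U be the n×n upper-triangular real matrix with entries u_{ij} = ∏_{k=1}^{i−1}(λ_j − λ_k) for 1 ≤ i ≤ j ≤ n and u_{ij} = 0 for i > j. Then det(U) = ∏_{1 ≤ k < i ≤ n}(λ_i − λ_k), which is nonzero, U is invertible, and ε_λ = U · D_λ · U^{−1} (equivalently, ε_λ · U = U · D_λ). -/
open Matrix

/-- The matrix `ε_λ` with `λ_i` on the diagonal and `1` on the superdiagonal. -/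
noncomputable def epsLam (n : ℕ) (lam : Fin n → ℝ) : Matrix (Fin n) (Fin n) ℝ :=
  Matrix.of fun i j => if i = j then lam i else if (i : ℕ) + 1 = (j : ℕ) then 1 else 0

/-- The upper triangular matrix with entries `u_{ij} = ∏_{k=1}^{i-1} (λ_j - λ_k)` for `i ≤ j`
(0-indexed: the product over `k < i`). -/
noncomputable def Umat0 (n : ℕ) (lam : Fin n → ℝ) : Matrix (Fin n) (Fin n) ℝ :=
  Matrix.of fun i j => if i ≤ j then ∏ k ∈ Finset.Iio i, (lam j - lam k) else 0

theorem Umat0_apply (n : ℕ) (lam : Fin n → ℝ) (i j : Fin n) :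
    Umat0 n lam i j = ∏ k ∈ Finset.Iio i, (lam j - lam k) := by
  simp only [Umat0, Matrix.of_apply]
  split_ifs with h
  · rfl
  · exact (Finset.prod_eq_zero (Finset.mem_Iio.2 (not_le.1 h)) (sub_self _)).symm

theorem det_Umat0 (n : ℕ) (lam : Fin n → ℝ) :
    (Umat0 n lam).det = ∏ i : Fin n, ∏ k ∈ Finset.Iio i, (lam i - lam k) := by
  have h : (Umat0 n lam).IsUpperTriangular := fun i j hij => if_neg (not_le.2 hij)
  simp only [Matrix.det_of_isUpperTriangular h, Umat0_apply]

theorem det_Umat0_ne_zero (n : ℕ) (lam : Fin n → ℝ) (hinj : Function.Injective lam) :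
    (Umat0 n lam).det ≠ 0 := by
  rw [det_Umat0]
  refine Finset.prod_ne_zero_iff.2 fun i _ => Finset.prod_ne_zero_iff.2 fun k hk => ?_
  exact sub_ne_zero.2 (hinj.ne (Finset.mem_Iio.1 hk).ne')

theorem mul_Umat0_apply (n : ℕ) (lam : Fin n → ℝ) (i j : Fin n) :
    (lam j - lam i) * Umat0 n lam i j = ∏ k ∈ Finset.Iic i, (lam j - lam k) := by
  rw [Umat0_apply, ← Finset.Iio_insert, Finset.prod_insert (by simp)]

theorem sum_superdiagonal_mul_Umat0 (n : ℕ) (lam : Fin n → ℝ) (i j : Fin n) :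
    ∑ k : Fin n, (if (i : ℕ) + 1 = (k : ℕ) then Umat0 n lam k j else 0) =
      ∏ k ∈ Finset.Iic i, (lam j - lam k) := by
  by_cases hi : (i : ℕ) + 1 < n
  · have hsucc : Finset.Iio (⟨i + 1, hi⟩ : Fin n) = Finset.Iic i := by
      ext k
      simp only [Finset.mem_Iio, Finset.mem_Iic, Fin.lt_def, Fin.le_def]
      lia
    rw [Finset.sum_eq_single_of_mem ⟨i + 1, hi⟩ (Finset.mem_univ _), if_pos rfl, Umat0_apply, hsucc]
    intro k _ hk
    exact if_neg fun h => hk (Fin.ext h.symm)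
  · rw [Finset.prod_eq_zero (i := j) (Finset.mem_Iic.2 (Fin.le_def.2 (by lia))) (sub_self _)]
    exact Finset.sum_eq_zero fun k _ => if_neg (by lia)

theorem epsLam_mul_Umat0 (n : ℕ) (lam : Fin n → ℝ) :
    epsLam n lam * Umat0 n lam = Umat0 n lam * Matrix.diagonal lam := by
  ext i j
  have hrow : ∀ k, epsLam n lam i k * Umat0 n lam k j =
      (if i = k then lam i * Umat0 n lam k j else 0) +
        (if (i : ℕ) + 1 = (k : ℕ) then Umat0 n lam k j else 0) := by
    intro k
    by_cases h : i = k
    · subst h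
      simp [epsLam]
    · simp [epsLam, h]
  rw [Matrix.mul_diagonal, Matrix.mul_apply, Finset.sum_congr rfl fun k _ => hrow k,
    Finset.sum_add_distrib, sum_superdiagonal_mul_Umat0, ← mul_Umat0_apply,
    Finset.sum_ite_eq, if_pos (Finset.mem_univ _)]
  ring

theorem stmt0 (n : ℕ) (lam : Fin n → ℝ) (hinj : Function.Injective lam) :
    (Umat0 n lam).det = ∏ i : Fin n, ∏ k ∈ Finset.Iio i, (lam i - lam k) ∧
    (Umat0 n lam).det ≠ 0 ∧
    IsUnit (Umat0 n lam) ∧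
    epsLam n lam * Umat0 n lam = Umat0 n lam * Matrix.diagonal lam ∧
    epsLam n lam = Umat0 n lam * Matrix.diagonal lam * (Umat0 n lam)⁻¹ := by
  have hdet : IsUnit (Umat0 n lam).det := (det_Umat0_ne_zero n lam hinj).isUnit
  refine ⟨det_Umat0 n lam, hdet.ne_zero, (Matrix.isUnit_iff_isUnit_det _).2 hdet,
    epsLam_mul_Umat0 n lam, ?_⟩
  rw [← epsLam_mul_Umat0, Matrix.mul_nonsing_inv_cancel_right _ _ hdet]
end

section
/- Let λ_1, …, λ_n be pairwise distinct real numbers. Then the inverse of U is given entrywise by (U^{−1})_{ij} = 0 for i > j, and (U^{−1})_{ij} = ∏_{m=i+1}^{j} 1/(λ_i − λ_m) for i ≤ j. -/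
open Matrix

/-- The upper triangular unipotent matrix `U(λ_1, …, λ_n)` with entries
`U_{ij} = ∏_{m=i}^{j-1} 1/(λ_j - λ_m)` for `i ≤ j` and `0` for `i > j`. -/
noncomputable def Umat (n : ℕ) (lam : Fin n → ℝ) : Matrix (Fin n) (Fin n) ℝ :=
  Matrix.of fun i j => if i ≤ j then ∏ m ∈ Finset.Ico i j, (lam j - lam m)⁻¹ else 0

theorem Lagrange.sum_nodalWeight_eq_zero {F ι : Type*} [Field F] [DecidableEq ι]
    {s : Finset ι} {v : ι → F} (hvs : Set.InjOn v s) (hs : 1 < s.card) :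
    ∑ i ∈ s, Lagrange.nodalWeight s v i = 0 := by
  have h := Lagrange.coeff_eq_sum hvs (P := (1 : Polynomial F))
    (by rw [Polynomial.degree_one]; exact_mod_cast (by lia : 0 < s.card))
  rw [Polynomial.coeff_one, if_neg (by lia)] at h
  simpa [Lagrange.nodalWeight, Finset.prod_inv_distrib] using h.symm

theorem Umat_mul_eq_one (n : ℕ) (lam : Fin n → ℝ) (hinj : Function.Injective lam) :
    Umat n lam * Matrix.of (fun i j : Fin n =>
      if i ≤ j then ∏ m ∈ Finset.Ioc i j, (lam i - lam m)⁻¹ else 0) = 1 := by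
  ext i k
  have hsum : ∑ j, Umat n lam i j *
      (if j ≤ k then ∏ m ∈ Finset.Ioc j k, (lam j - lam m)⁻¹ else 0) =
      ∑ j ∈ Finset.Icc i k, Lagrange.nodalWeight (Finset.Icc i k) lam j := by
    rw [← Finset.sum_subset (Finset.subset_univ (Finset.Icc i k))]
    · refine Finset.sum_congr rfl fun j hj => ?_
      obtain ⟨hij, hjk⟩ := Finset.mem_Icc.mp hj
      have hunion : (Finset.Icc i k).erase j = Finset.Ico i j ∪ Finset.Ioc j k := by
        ext m
        simp only [Finset.mem_erase, Finset.mem_Icc, Finset.mem_union, Finset.mem_Ico,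
          Finset.mem_Ioc]
        lia
      have hdisj : Disjoint (Finset.Ico i j) (Finset.Ioc j k) := by
        rw [Finset.disjoint_left]
        simp only [Finset.mem_Ico, Finset.mem_Ioc]
        lia
      rw [Lagrange.nodalWeight, hunion, Finset.prod_union hdisj]
      simp [Umat, hij, hjk]
    · intro j _ hj
      simp only [Umat, Matrix.of_apply]
      split_ifs with hij hjk <;> simp_all
  simp only [Matrix.mul_apply, Matrix.of_apply]
  rw [hsum]
  rcases lt_trichotomy i k with h | rfl | h
  · rw [Matrix.one_apply_ne h.ne, Lagrange.sum_nodalWeight_eq_zero hinj.injOn]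
    exact Finset.one_lt_card.mpr
      ⟨i, Finset.left_mem_Icc.mpr h.le, k, Finset.right_mem_Icc.mpr h.le, h.ne⟩
  · simp [Lagrange.nodalWeight]
  · rw [Matrix.one_apply_ne h.ne', Finset.Icc_eq_empty h.not_ge, Finset.sum_empty]

theorem stmt3 (n : ℕ) (lam : Fin n → ℝ) (hinj : Function.Injective lam) :
    ∀ i j : Fin n,
      (Umat n lam)⁻¹ i j =
        if i ≤ j then ∏ m ∈ Finset.Ioc i j, (lam i - lam m)⁻¹ else 0 := by
  intro i j
  rw [Matrix.inv_eq_right_inv (Umat_mul_eq_one n lam hinj), Matrix.of_apply]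
end

section
/- Let λ_1, …, λ_n be pairwise distinct real numbers and let 1 ≤ k ≤ n−1. Then the top-right k×k minor of U^{−1} satisfies Δ_k^n(U^{−1}) = ∏_{j=1}^{k} ∏_{i=k+1}^{n} 1/(λ_j − λ_i). -/
open Matrix

/-- `Δ_k^n(X)`: the determinant of the top-right `k × k` submatrix of `X`
(rows `1, …, k` and columns `n-k+1, …, n`). -/
noncomputable def topRightMinor {n : ℕ} (k : ℕ) (hk : k ≤ n)
    (X : Matrix (Fin n) (Fin n) ℝ) : ℝ :=
  Matrix.det (Matrix.of fun i j : Fin k =>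
    X (Fin.castLE hk i) ⟨n - k + (j : ℕ), by have := j.isLt; omega⟩)

open Finset Lagrange in
/-- The inverse of `U` has entries
`∏ m > j, (lam i - lam m) / ∏ m > i, (lam i - lam m)`, which vanish for `i > j`. -/
theorem inv_Umat (n : ℕ) (lam : Fin n → ℝ) (hinj : Function.Injective lam) :
    (Umat n lam)⁻¹ = Matrix.of fun i j =>
      (∏ m ∈ Ioi i, (lam i - lam m))⁻¹ * (nodal (Ioi j) lam).eval (lam i) := by
  apply Matrix.inv_eq_right_inv
  ext i j
  have hsum : (Umat n lam * Matrix.of fun i j =>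
      (∏ m ∈ Ioi i, (lam i - lam m))⁻¹ * (nodal (Ioi j) lam).eval (lam i)) i j =
      ∑ l ∈ Ici i, (nodal (Ioi j) lam).eval (lam l) / ∏ m ∈ (Ici i).erase l, (lam l - lam m) := by
    simp only [Umat, Matrix.mul_apply, Matrix.of_apply, ite_mul, zero_mul]
    rw [← sum_filter, Finset.filter_le_eq_Ici]
    refine sum_congr rfl fun l hl => ?_
    have hsplit : (Ici i).erase l = Ico i l ∪ Ioi l := by
      ext m
      simp only [mem_Ici] at hl
      simp only [mem_erase, mem_Ici, mem_union, mem_Ico, mem_Ioi]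
      grind
    have hdisj : Disjoint (Ico i l) (Ioi l) := by
      rw [Finset.disjoint_left]
      intro m
      simp only [mem_Ico, mem_Ioi]
      grind
    rw [hsplit, prod_union hdisj, prod_inv_distrib, div_eq_mul_inv, mul_inv]
    ring
  rw [hsum, Matrix.one_apply]
  rcases lt_or_ge j i with hji | hij
  · rw [if_neg hji.ne']
    refine sum_eq_zero fun l hl => ?_
    rw [eval_nodal_at_node (mem_Ioi.2 (hji.trans_le (mem_Ici.1 hl))), zero_div]
  · have hdeg : (nodal (Ioi j) lam).degree < #(Ici i) := by
      rw [degree_nodal, Fin.card_Ioi, Fin.card_Ici]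
      norm_cast
      omega
    rw [← coeff_eq_sum hinj.injOn hdeg]
    split_ifs with h
    · subst h
      have hcard : #(Ici i) - 1 = (nodal (Ioi i) lam).natDegree := by
        rw [natDegree_nodal, Fin.card_Ioi, Fin.card_Ici]
        omega
      rw [hcard]
      exact nodal_monic
    · apply Polynomial.coeff_eq_zero_of_natDegree_lt
      rw [natDegree_nodal, Fin.card_Ioi, Fin.card_Ici]
      omega

open Finset in
theorem Fin.prod_Ioi_castLE {M : Type*} [CommMonoid M] {n k : ℕ} (hk : k ≤ n) (f : Fin n → M)
    (p : Fin k) :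
    ∏ m ∈ Ioi (Fin.castLE hk p), f m =
      (∏ j ∈ Ioi p, f (Fin.castLE hk j)) *
        ∏ q : Fin (n - k), f ⟨k + (q : ℕ), by have := q.isLt; omega⟩ := by
  obtain ⟨l, rfl⟩ := Nat.exists_eq_add_of_le hk
  have hq : ∏ q : Fin (k + l - k), f ⟨k + (q : ℕ), by have := q.isLt; omega⟩ =
      ∏ q : Fin l, f (Fin.natAdd k q) :=
    Fintype.prod_equiv (finCongr (by omega)) _ _ fun q => rfl
  rw [hq, ← Finset.filter_lt_eq_Ioi, ← Finset.filter_lt_eq_Ioi, prod_filter, prod_filter,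
    Fin.prod_univ_add]
  congr 1
  refine prod_congr rfl fun q _ => if_pos ?_
  rw [Fin.lt_def]
  simp only [Fin.val_castLE, Fin.val_natAdd]
  omega

open Finset Lagrange in
/-- The Vandermonde determinant with rows and columns in reverse order, in terms of nodal
polynomials. -/
theorem det_eval_nodal_Ioi {R : Type*} [CommRing R] [Nontrivial R] {n k : ℕ} (hk : k ≤ n)
    (lam : Fin n → R) (v : Fin k → R) :
    (Matrix.of fun i j : Fin k => (nodal (Ioi (⟨n - k + (j : ℕ), by
      have := j.isLt; omega⟩ : Fin n)) lam).eval (v i)).det =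
      ∏ i, ∏ j ∈ Ioi i, (v i - v j) := by
  rw [← Matrix.det_submatrix_equiv_self Fin.revPerm]
  refine (Matrix.det_eval_matrixOfPolynomials_eq_det_vandermonde (v ∘ Fin.rev)
    (fun j => nodal (Ioi (⟨n - k + (j.rev : ℕ), by have := j.rev.isLt; omega⟩ : Fin n)) lam)
    (fun j => ?_) fun j => nodal_monic).symm.trans ?_
  · rw [natDegree_nodal, Fin.card_Ioi]
    have := j.isLt
    simp only [Fin.val_rev]
    omega
  · rw [Matrix.det_vandermonde, prod_sigma', prod_sigma']
    refine prod_nbij' (fun x => ⟨x.2.rev, x.1.rev⟩) (fun x => ⟨x.2.rev, x.1.rev⟩)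
      ?_ ?_ ?_ ?_ ?_ <;> simp

theorem stmt4 (n k : ℕ) (hk1 : 1 ≤ k) (hk2 : k ≤ n - 1)
    (lam : Fin n → ℝ) (hinj : Function.Injective lam) :
    topRightMinor k (by omega) ((Umat n lam)⁻¹) =
      ∏ p : Fin k, ∏ q : Fin (n - k),
        (lam ⟨(p : ℕ), by have := p.isLt; omega⟩ -
         lam ⟨k + (q : ℕ), by have := q.isLt; omega⟩)⁻¹ := by
  have hk : k ≤ n := by omega
  rw [topRightMinor, inv_Umat n lam hinj]
  simp only [Matrix.of_apply]
  refine (Matrix.det_mul_column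
    (fun i : Fin k => (∏ m ∈ Finset.Ioi (Fin.castLE hk i), (lam (Fin.castLE hk i) - lam m))⁻¹)
    (Matrix.of fun i j : Fin k => (Lagrange.nodal (Finset.Ioi (⟨n - k + (j : ℕ), by
      have := j.isLt; omega⟩ : Fin n)) lam).eval (lam (Fin.castLE hk i)))).trans ?_
  rw [det_eval_nodal_Ioi hk lam fun i => lam (Fin.castLE hk i), ← Finset.prod_mul_distrib]
  refine Finset.prod_congr rfl fun p _ => ?_
  have hne : ∏ j ∈ Finset.Ioi p, (lam (Fin.castLE hk p) - lam (Fin.castLE hk j)) ≠ 0 :=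
    Finset.prod_ne_zero_iff.2 fun j hj => sub_ne_zero.2 fun h =>
      (Finset.mem_Ioi.1 hj).ne (Fin.castLE_injective hk (hinj h))
  rw [Fin.prod_Ioi_castLE, _root_.mul_inv_rev, inv_mul_cancel_right₀ hne, ← Finset.prod_inv_distrib]
  rfl
end

section
/- For every n ≥ 1, the n×n real matrix A defined by A_{ii} = −1 and A_{i,i+1} = 1 for 1 ≤ i ≤ n−1, A_{nj} = 1 for all 1 ≤ j ≤ n, and all other entries 0, has determinant n·(−1)^{n+1}; in particular, A is invertible. -/
/-- The coefficient matrix of the box-ball phase-shift linear system: `-1` on the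
diagonal and `1` on the superdiagonal in the first `n-1` rows, and all `1`s in
the last row. -/
noncomputable def Amat (n : ℕ) : Matrix (Fin n) (Fin n) ℝ :=
  Matrix.of fun i j =>
    if (i : ℕ) = n - 1 then 1
    else if i = j then -1
    else if (j : ℕ) = (i : ℕ) + 1 then 1
    else 0

/-- The upper unitriangular matrix of ones, whose columns compute partial sums. -/
def upperOnes (n : ℕ) : Matrix (Fin n) (Fin n) ℝ :=
  Matrix.of fun i j => if i ≤ j then 1 else 0

theorem det_upperOnes (n : ℕ) : (upperOnes n).det = 1 := by
  rw [Matrix.det_of_isUpperTriangular]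
  · simp [upperOnes]
  · intro i j h
    simp_all [upperOnes]

theorem Amat_castSucc (m : ℕ) (i : Fin m) (j : Fin (m + 1)) :
    Amat (m + 1) i.castSucc j =
      (if j = i.succ then 1 else 0) - (if j = i.castSucc then 1 else 0) := by
  have := i.isLt
  simp only [Amat, Matrix.of_apply, Fin.ext_iff, Fin.val_castSucc, Fin.val_succ]
  split_ifs <;> first | omega | norm_num

theorem Amat_mul_upperOnes_castSucc (m : ℕ) (i : Fin m) (k : Fin (m + 1)) :
    (Amat (m + 1) * upperOnes (m + 1)) i.castSucc k = if i.castSucc = k then -1 else 0 := by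
  simp only [Matrix.mul_apply, Amat_castSucc, sub_mul, Finset.sum_sub_distrib, ite_mul, one_mul,
    zero_mul, Finset.sum_ite_eq', Finset.mem_univ, if_true, upperOnes, Matrix.of_apply]
  simp only [Fin.ext_iff, Fin.le_def, Fin.val_castSucc, Fin.val_succ]
  split_ifs <;> first | omega | norm_num

theorem Amat_mul_upperOnes_last (m : ℕ) :
    (Amat (m + 1) * upperOnes (m + 1)) (Fin.last m) (Fin.last m) = m + 1 := by
  simp [Matrix.mul_apply, Amat, upperOnes, Fin.le_last]

theorem det_Amat_succ (m : ℕ) : (Amat (m + 1)).det = (m + 1) * (-1) ^ m := by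
  have h : (Amat (m + 1)).det = (Amat (m + 1) * upperOnes (m + 1)).det := by
    rw [Matrix.det_mul, det_upperOnes, mul_one]
  rw [h, Matrix.det_of_isLowerTriangular]
  · rw [Fin.prod_univ_castSucc, Amat_mul_upperOnes_last]
    simp [Amat_mul_upperOnes_castSucc, mul_comm]
  · intro i k h
    have h' : i < k := h
    obtain ⟨i, rfl⟩ := Fin.exists_castSucc_eq.2 (h'.trans_le (Fin.le_last k)).ne
    rw [Amat_mul_upperOnes_castSucc, if_neg h'.ne]

theorem stmt11 (n : ℕ) (hn : 1 ≤ n) :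
    (Amat n).det = n * (-1) ^ (n + 1) ∧ IsUnit (Amat n) := by
  obtain ⟨m, rfl⟩ := Nat.exists_eq_add_of_le' hn
  have hdet : (Amat (m + 1)).det = ((m + 1 : ℕ) : ℝ) * (-1) ^ (m + 1 + 1) := by
    rw [det_Amat_succ]
    push_cast
    ring
  refine ⟨hdet, (Matrix.isUnit_iff_isUnit_det _).2 ?_⟩
  rw [hdet, isUnit_iff_ne_zero]
  positivity
end

section
/- Let λ_1, …, λ_n be elements of a commutative ring (in particular, real numbers) and let 1 ≤ j ≤ n. Then ∏_{i=1}^{j−1}(λ_n − λ_i) = ∑_{m=1}^{j} (∏_{p=m+1}^{j}(λ_n − λ_p)) · (∏_{l=1}^{m−1}(λ_j − λ_l)). -/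
theorem sum_Icc_prod_Icc_mul_succ {R : Type*} [CommRing R] (g h : ℕ → R) (k : ℕ) :
    ∑ m ∈ Finset.Icc 1 (k + 1), (∏ p ∈ Finset.Icc (m + 1) (k + 1), g p) * h m =
      g (k + 1) * ∑ m ∈ Finset.Icc 1 k, (∏ p ∈ Finset.Icc (m + 1) k, g p) * h m
        + h (k + 1) := by
  rw [Finset.sum_Icc_succ_top (by omega), Finset.mul_sum]
  congr 1
  · refine Finset.sum_congr rfl fun m hm => ?_
    have hmk := (Finset.mem_Icc.mp hm).2
    rw [Finset.prod_Icc_succ_top (by omega)]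
    ring
  · simp

theorem prod_Icc_sub_eq_sub_mul_sum_add {R : Type*} [CommRing R] (x y : R) (f : ℕ → R)
    (k : ℕ) :
    ∏ i ∈ Finset.Icc 1 k, (x - f i) =
      (x - y) * ∑ m ∈ Finset.Icc 1 k,
        (∏ p ∈ Finset.Icc (m + 1) k, (x - f p)) * ∏ l ∈ Finset.Icc 1 (m - 1), (y - f l)
      + ∏ l ∈ Finset.Icc 1 k, (y - f l) := by
  induction k with
  | zero => simp
  | succ k ih =>
    rw [sum_Icc_prod_Icc_mul_succ (fun p => x - f p)
        (fun m => ∏ l ∈ Finset.Icc 1 (m - 1), (y - f l)),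
      Finset.prod_Icc_succ_top (by omega), Finset.prod_Icc_succ_top (by omega),
      Nat.add_sub_cancel]
    linear_combination (x - f (k + 1)) * ih

theorem stmt15 {R : Type*} [CommRing R] (n j : ℕ) (h1 : 1 ≤ j) (h2 : j ≤ n)
    (lam : ℕ → R) :
    ∏ i ∈ Finset.Icc 1 (j - 1), (lam n - lam i) =
      ∑ m ∈ Finset.Icc 1 j,
        (∏ p ∈ Finset.Icc (m + 1) j, (lam n - lam p)) *
          ∏ l ∈ Finset.Icc 1 (m - 1), (lam j - lam l) := by
  obtain ⟨k, rfl⟩ := Nat.exists_eq_add_of_le' h1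
  rw [sum_Icc_prod_Icc_mul_succ (fun p => lam n - lam p)
      (fun m => ∏ l ∈ Finset.Icc 1 (m - 1), (lam (k + 1) - lam l)),
    Nat.add_sub_cancel]
  exact prod_Icc_sub_eq_sub_mul_sum_add (lam n) (lam (k + 1)) lam k
end

section
/- Let λ_1, …, λ_n be pairwise distinct real numbers and let j satisfy 1 < j < n. Then ∏_{m=1}^{j−1} 1/(λ_j − λ_m) = ∑_{m=1}^{j} [(λ_n − λ_j)/(λ_n − λ_m)] · (∏_{p=1}^{m−1} 1/(λ_n − λ_p)) · (∏_{l=m}^{j−1} 1/(λ_j − λ_l)). -/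
theorem prod_inv_sub_eq_sum_add_prod_inv_sub {K : Type*} [Field K] (f : ℕ → K) (x y : K) (k : ℕ)
    (hx : ∀ m ∈ Finset.Icc 1 k, x - f m ≠ 0) (hy : ∀ m ∈ Finset.Icc 1 k, y - f m ≠ 0) :
    ∏ m ∈ Finset.Icc 1 k, (y - f m)⁻¹ =
      ∑ m ∈ Finset.Icc 1 k,
        (x - y) / (x - f m) * (∏ p ∈ Finset.Icc 1 (m - 1), (x - f p)⁻¹) *
          ∏ l ∈ Finset.Icc m k, (y - f l)⁻¹ +
      ∏ p ∈ Finset.Icc 1 k, (x - f p)⁻¹ := by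
  induction k with
  | zero => simp
  | succ k ih =>
    have hsub : Finset.Icc 1 k ⊆ Finset.Icc 1 (k + 1) :=
      Finset.Icc_subset_Icc_right k.le_succ
    have hxk := hx (k + 1) (by simp)
    have hyk := hy (k + 1) (by simp)
    have hsum : ∑ m ∈ Finset.Icc 1 k,
        (x - y) / (x - f m) * (∏ p ∈ Finset.Icc 1 (m - 1), (x - f p)⁻¹) *
          ∏ l ∈ Finset.Icc m (k + 1), (y - f l)⁻¹ =
        (∑ m ∈ Finset.Icc 1 k,
          (x - y) / (x - f m) * (∏ p ∈ Finset.Icc 1 (m - 1), (x - f p)⁻¹) *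
            ∏ l ∈ Finset.Icc m k, (y - f l)⁻¹) * (y - f (k + 1))⁻¹ := by
      rw [Finset.sum_mul]
      refine Finset.sum_congr rfl fun m hm => ?_
      rw [Finset.prod_Icc_succ_top (by have := (Finset.mem_Icc.mp hm).2; lia), ← mul_assoc]
    rw [Finset.sum_Icc_succ_top (by lia), hsum, Finset.Icc_self, Finset.prod_singleton,
      Finset.prod_Icc_succ_top (by lia), Finset.prod_Icc_succ_top (by lia),
      ih (fun m hm => hx m (hsub hm)) (fun m hm => hy m (hsub hm)), add_mul, add_assoc,
      Nat.add_sub_cancel]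
    congr 1
    generalize ∏ p ∈ Finset.Icc 1 k, (x - f p)⁻¹ = P
    field_simp
    ring

theorem stmt16 (n j : ℕ) (hj1 : 1 < j) (hj2 : j < n)
    (lam : ℕ → ℝ) (hinj : Set.InjOn lam (Set.Icc 1 n)) :
    ∏ m ∈ Finset.Icc 1 (j - 1), (lam j - lam m)⁻¹ =
      ∑ m ∈ Finset.Icc 1 j,
        (lam n - lam j) / (lam n - lam m) *
          (∏ p ∈ Finset.Icc 1 (m - 1), (lam n - lam p)⁻¹) *
            ∏ l ∈ Finset.Icc m (j - 1), (lam j - lam l)⁻¹ := by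
  have hne : ∀ a b, 1 ≤ b → b < a → a ≤ n → lam a - lam b ≠ 0 := fun a b hb hba han h =>
    hba.ne' (hinj ⟨by lia, han⟩ ⟨hb, by lia⟩ (sub_eq_zero.mp h))
  obtain ⟨k, rfl⟩ : ∃ k, j = k + 1 := ⟨j - 1, by lia⟩
  rw [Finset.sum_Icc_succ_top (by lia), Nat.add_sub_cancel,
    div_self (hne n (k + 1) (by lia) hj2 le_rfl), Finset.Icc_eq_empty (a := k + 1) (by lia),
    Finset.prod_empty, one_mul, mul_one]
  refine prod_inv_sub_eq_sum_add_prod_inv_sub lam _ _ k (fun m hm => ?_) fun m hm => ?_ <;>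
    rw [Finset.mem_Icc] at hm
  · exact hne n m hm.1 (by lia) le_rfl
  · exact hne (k + 1) m hm.1 (by lia) hj2.le
end

section
/- Let λ_1, …, λ_n be pairwise distinct real numbers. Let V be the n×n matrix with V_{ij} = ∏_{m=i+1}^{j} 1/(λ_i − λ_m) for i ≤ j and V_{ij} = 0 for i > j. Then V = ŵ_0 · U(λ_n, …, λ_1)ᵀ · ŵ_0, where U(λ_n, …, λ_1) is the unipotent eigenvector matrix built from the reversed sequence λ_n, …, λ_1; equivalently, U(λ_1, …, λ_n)^{−1} = (ŵ_0 · U(λ_n, …, λ_1) · ŵ_0)ᵀ. -/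
open Matrix

/-- The matrix `V` with `V_{ij} = ∏_{m=i+1}^{j} 1/(λ_i - λ_m)` for `i ≤ j` and `0`
for `i > j`. -/
noncomputable def Vmat (n : ℕ) (lam : Fin n → ℝ) : Matrix (Fin n) (Fin n) ℝ :=
  Matrix.of fun i j => if i ≤ j then ∏ m ∈ Finset.Ioc i j, (lam i - lam m)⁻¹ else 0

/-- The antidiagonal permutation matrix `ŵ_0`. -/
noncomputable def w0Mat (n : ℕ) : Matrix (Fin n) (Fin n) ℝ :=
  Matrix.of fun i j => if j = Fin.rev i then 1 else 0

/-- The partial fraction identity `∑_{i ∈ s} ∏_{j ∈ s, j ≠ i} 1/(v_i - v_j) = 0` for at least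
two distinct nodes. -/
theorem sum_prod_erase_inv_sub_eq_zero {F ι : Type*} [Field F] [DecidableEq ι] {s : Finset ι}
    {v : ι → F} (hvs : Set.InjOn v s) (hs : 1 < s.card) :
    ∑ i ∈ s, ∏ j ∈ s.erase i, (v i - v j)⁻¹ = 0 := by
  have h := Lagrange.coeff_eq_sum hvs (P := 1)
    (by rw [Polynomial.degree_one]; exact_mod_cast (by omega : 0 < s.card))
  rw [Polynomial.coeff_one, if_neg (by omega)] at h
  simpa [Finset.prod_inv_distrib] using h.symm

theorem w0Mat_mul_mul_w0Mat_apply (n : ℕ) (A : Matrix (Fin n) (Fin n) ℝ) (i j : Fin n) :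
    (w0Mat n * A * w0Mat n) i j = A i.rev j.rev := by
  have hrev (k : Fin n) : j = k.rev ↔ k = j.rev := by rw [eq_comm, Fin.rev_eq_iff]
  simp [w0Mat, Matrix.mul_apply, hrev]

theorem Umat_comp_rev_apply (n : ℕ) (lam : Fin n → ℝ) (i j : Fin n) :
    Umat n (lam ∘ Fin.rev) j.rev i.rev = Vmat n lam i j := by
  simp only [Umat, Vmat, Matrix.of_apply, Fin.rev_le_rev]
  rw [← Fin.map_revPerm_Ioc, Finset.prod_map]
  simp

theorem Umat_mul_Vmat (n : ℕ) (lam : Fin n → ℝ) (hinj : Function.Injective lam) :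
    Umat n lam * Vmat n lam = 1 := by
  ext i j
  have hsum : (Umat n lam * Vmat n lam) i j =
      ∑ k ∈ Finset.Icc i j, ∏ m ∈ (Finset.Icc i j).erase k, (lam k - lam m)⁻¹ := by
    rw [Matrix.mul_apply, ← Finset.sum_subset (Finset.subset_univ (Finset.Icc i j))]
    · refine Finset.sum_congr rfl fun k hk => ?_
      obtain ⟨hik, hkj⟩ := Finset.mem_Icc.1 hk
      have hdisj : Disjoint (Finset.Ico i k) (Finset.Ioc k j) :=
        Finset.disjoint_left.2 fun m hm hm' =>
          lt_asymm (Finset.mem_Ico.1 hm).2 (Finset.mem_Ioc.1 hm').1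
      have hunion : (Finset.Icc i j).erase k = Finset.Ico i k ∪ Finset.Ioc k j := by
        ext m
        simp only [Finset.mem_erase, Finset.mem_union, Finset.mem_Icc, Finset.mem_Ico,
          Finset.mem_Ioc]
        grind
      rw [hunion, Finset.prod_union hdisj]
      simp [Umat, Vmat, hik, hkj]
    · intro k _ hk
      rw [Finset.mem_Icc, not_and_or] at hk
      rcases hk with hk | hk <;> simp [Umat, Vmat, hk]
  rw [hsum]
  rcases lt_trichotomy i j with hij | rfl | hij
  · rw [Matrix.one_apply_ne hij.ne]
    refine sum_prod_erase_inv_sub_eq_zero hinj.injOn (Finset.one_lt_card.2 ⟨i, ?_, j, ?_, hij.ne⟩)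
    · exact Finset.left_mem_Icc.2 hij.le
    · exact Finset.right_mem_Icc.2 hij.le
  · simp
  · rw [Matrix.one_apply_ne hij.ne', Finset.Icc_eq_empty hij.not_ge, Finset.sum_empty]

theorem stmt18 (n : ℕ) (lam : Fin n → ℝ) (hinj : Function.Injective lam) :
    Vmat n lam = w0Mat n * (Umat n (lam ∘ Fin.rev))ᵀ * w0Mat n ∧
    (Umat n lam)⁻¹ = (w0Mat n * Umat n (lam ∘ Fin.rev) * w0Mat n)ᵀ := by
  refine ⟨?_, ?_⟩
  · ext i j
    rw [w0Mat_mul_mul_w0Mat_apply, Matrix.transpose_apply, Umat_comp_rev_apply]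
  · rw [Matrix.inv_eq_right_inv (Umat_mul_Vmat n lam hinj)]
    ext i j
    rw [Matrix.transpose_apply, w0Mat_mul_mul_w0Mat_apply, Umat_comp_rev_apply]
end
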